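/- arXiv:1403.0426 — 6 statements merged into one kernel-verified Lean document; each statement's English description precedes it below -/
import Mathlib

section
/- Let k ≥ 1 and let Q : ℝ → Matrix (Fin k) (Fin k) ℝ be continuous on [t,T] with nonnegative off-diagonal entries (Q(s)_{ij} ≥ 0 for i ≠ j) and with all entries bounded in absolute value by a constant C. If P : ℝ → Matrix (Fin k) (Fin k) ℝ satisfies P(t) = 1 and P'(s) = P(s) * Q(s) for all s ∈ [t,T], then all entries of P(s) are nonnegative for every s ∈ [t,T]. (Nonnegativity part of Proposition 2.3.) -/
lemma aux_deriv (x : ℝ) : HasDerivAt (fun y : ℝ => (min y 0)^2) (2 * min x 0) x := by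
  rcases lt_trichotomy x 0 with h | h | h
  · have h1 : HasDerivAt (fun y : ℝ => y^2) (2 * min x 0) x := by
      rw [min_eq_left h.le]
      simpa using hasDerivAt_pow 2 x
    refine h1.congr_of_eventuallyEq ?_
    filter_upwards [Iio_mem_nhds h] with y hy
    rw [min_eq_left (le_of_lt hy)]
  · subst h
    rw [hasDerivAt_iff_isLittleO]
    have h2 : (fun y : ℝ => y^2) =o[nhds 0] (fun y : ℝ => y) := by
      simpa using (Asymptotics.isLittleO_pow_id (𝕜 := ℝ) (n := 2) (by norm_num))
    have h3 : (fun y : ℝ => (min y 0)^2) =O[nhds 0] (fun y : ℝ => y^2) := by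
      refine Asymptotics.IsBigO.of_bound 1 (Filter.Eventually.of_forall fun y => ?_)
      rw [Real.norm_eq_abs, Real.norm_eq_abs, abs_of_nonneg (sq_nonneg _),
        abs_of_nonneg (sq_nonneg _), one_mul]
      rcases le_total y 0 with h | h
      · rw [min_eq_left h]
      · rw [min_eq_right h]; simpa using sq_nonneg y
    simpa using h3.trans_isLittleO h2
  · have h1 : HasDerivAt (fun y : ℝ => (0:ℝ)) (2 * min x 0) x := by
      rw [min_eq_right h.le]
      simpa using hasDerivAt_const x (0:ℝ)
    refine h1.congr_of_eventuallyEq ?_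
    filter_upwards [Ioi_mem_nhds h] with y hy
    rw [min_eq_right (le_of_lt hy)]; simp

lemma aux_term (a b q C : ℝ) (hq : |q| ≤ C) (h : 0 ≤ q ∨ a = b) :
    2 * min a 0 * (b * q) ≤ C * ((min a 0)^2 + (min b 0)^2) := by
  have hC : 0 ≤ C := (abs_nonneg q).trans hq
  obtain ⟨hq1, hq2⟩ := abs_le.1 hq
  rcases h with h | h
  · have h1 : min a 0 * (b * q) ≤ min a 0 * (min b 0 * q) :=
      mul_le_mul_of_nonpos_left (mul_le_mul_of_nonneg_right (min_le_left _ _) h) (min_le_right _ _)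
    have h2 : 0 ≤ min a 0 * min b 0 :=
      mul_nonneg_of_nonpos_of_nonpos (min_le_right _ _) (min_le_right _ _)
    nlinarith [mul_le_mul_of_nonneg_left hq2 h2, mul_nonneg hC (sq_nonneg (min a 0 - min b 0))]
  · subst h
    have : min a 0 * a = (min a 0)^2 := by
      rcases le_total a 0 with h | h
      · rw [min_eq_left h]; ring
      · rw [min_eq_right h]; ring
    have h3 : 2 * min a 0 * (a * q) = 2 * (min a 0)^2 * q := by rw [← this]; ring
    rw [h3]
    nlinarith [mul_le_mul_of_nonneg_left hq2 (sq_nonneg (min a 0))]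

/-- Nonnegativity part of Proposition 2.3: the time-ordered exponential of a family of
matrices with nonnegative off-diagonal entries and bounded entries has nonnegative entries. -/
theorem stmt_1 (k : ℕ) (hk : 1 ≤ k) (t T C : ℝ)
    (Q P : ℝ → Matrix (Fin k) (Fin k) ℝ)
    (hQcont : ContinuousOn Q (Set.Icc t T))
    (hQoffdiag : ∀ s ∈ Set.Icc t T, ∀ i j, i ≠ j → 0 ≤ Q s i j)
    (hQbound : ∀ s ∈ Set.Icc t T, ∀ i j, |Q s i j| ≤ C)
    (hPinit : P t = 1)
    (hPderiv : ∀ s ∈ Set.Icc t T, ∀ i j,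
      HasDerivAt (fun r => P r i j) ((P s * Q s) i j) s) :
    ∀ s ∈ Set.Icc t T, ∀ i j, 0 ≤ P s i j := by
  intro s hs i
  let E : ℝ → ℝ := fun r => ∑ j, (min (P r i j) 0)^2
  let E' : ℝ → ℝ := fun r => ∑ j, 2 * min (P r i j) 0 * (P r * Q r) i j
  let K : ℝ := 2 * C * k
  have hE : ∀ r ∈ Set.Icc t T, HasDerivAt E (E' r) r := fun r hr =>
    HasDerivAt.fun_sum fun j _ => HasDerivAt.comp (h₂ := fun y : ℝ => (min y 0)^2) (h := fun r => P r i j) r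
      (aux_deriv (P r i j)) (hPderiv r hr i j)
  have hE' : ∀ r ∈ Set.Icc t T, E' r ≤ K * E r := by
    intro r hr
    calc E' r = ∑ j, ∑ l, 2 * min (P r i j) 0 * (P r i l * Q r l j) := by
          simp only [E', Matrix.mul_apply, Finset.mul_sum]
      _ ≤ ∑ j, ∑ l, C * ((min (P r i j) 0)^2 + (min (P r i l) 0)^2) := by
          refine Finset.sum_le_sum fun j _ => Finset.sum_le_sum fun l _ => ?_
          refine aux_term _ _ _ _ (hQbound r hr l j) ?_
          by_cases h : l = j
          · right; rw [h]
          · left; exact hQoffdiag r hr l j h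
      _ = K * E r := by
          simp only [← Finset.mul_sum, Finset.sum_add_distrib, Finset.sum_const,
            Finset.card_univ, Fintype.card_fin, nsmul_eq_mul, K, E]
          ring
  have hF : ∀ r ∈ Set.Icc t T, HasDerivAt (fun r => E r * Real.exp (-K * r))
      (E' r * Real.exp (-K * r) + E r * (Real.exp (-K * r) * (-K))) r := by
    intro r hr
    have h1 : HasDerivAt (fun r : ℝ => -K * r) (-K) r := by
      simpa using (hasDerivAt_id r).const_mul (-K)
    exact (hE r hr).mul h1.exp
  have hanti : AntitoneOn (fun r => E r * Real.exp (-K * r)) (Set.Icc t T) := by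
    refine antitoneOn_of_deriv_nonpos (convex_Icc t T)
      (fun r hr => (hF r hr).continuousAt.continuousWithinAt)
      (fun r hr => (hF r (interior_subset hr)).differentiableAt.differentiableWithinAt) ?_
    intro r hr
    have hr' := interior_subset hr
    rw [(hF r hr').deriv]
    nlinarith [mul_le_mul_of_nonneg_right (hE' r hr') (Real.exp_pos (-K * r)).le]
  have ht : t ∈ Set.Icc t T := ⟨le_rfl, hs.1.trans hs.2⟩
  have hEt : E t = 0 := by
    refine Finset.sum_eq_zero fun j _ => ?_
    rw [hPinit, Matrix.one_apply]
    split_ifs <;> simp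
  have hfin := hanti ht hs hs.1
  simp only [hEt, zero_mul] at hfin
  have hEs : E s ≤ 0 := by
    by_contra! h
    exact absurd hfin (not_le.2 (mul_pos h (Real.exp_pos _)))
  intro j
  have h1 : (min (P s i j) 0)^2 ≤ E s :=
    Finset.single_le_sum (f := fun j => (min (P s i j) 0)^2)
      (fun j _ => sq_nonneg _) (Finset.mem_univ j)
  have h2 : min (P s i j) 0 = 0 := by
    have : (min (P s i j) 0)^2 = 0 := le_antisymm (h1.trans hEs) (sq_nonneg _)
    exact pow_eq_zero_iff (two_ne_zero) |>.1 this
  exact min_eq_right_iff.1 h2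
end

section
/- Let k ≥ 1, let t ∈ ℝ, and let P : ℝ → Matrix (Fin k) (Fin k) ℝ satisfy: P(t) = 1; the map s ↦ P(s) is differentiable at s = t with derivative Q; and for every s ≥ t the matrix P(s) is stochastic, i.e. all entries of P(s) are nonnegative and every row sum of P(s) equals 1. Then Q is a Q-matrix: Q_{ij} ≥ 0 for all i ≠ j, and ∑_j Q_{ij} = 0 for every i. (Converse part of Proposition 2.3.) -/
/-- Converse part of Proposition 2.3: if `P t = 1`, `P` is differentiable at `t` with
derivative `Q`, and `P s` is a stochastic matrix for every `s ≥ t`, then `Q` is a Q-matrix. -/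
theorem stmt_2 (k : ℕ) (hk : 1 ≤ k) (t : ℝ)
    (P : ℝ → Matrix (Fin k) (Fin k) ℝ) (Q : Matrix (Fin k) (Fin k) ℝ)
    (hPinit : P t = 1)
    (hPderiv : ∀ i j, HasDerivAt (fun s => P s i j) (Q i j) t)
    (hstoch : ∀ s, t ≤ s → (∀ i j, 0 ≤ P s i j) ∧ (∀ i, ∑ j, P s i j = 1)) :
    (∀ i j, i ≠ j → 0 ≤ Q i j) ∧ (∀ i, ∑ j, Q i j = 0) := by
  constructor
  · intro i j hij
    have h := (hPderiv i j).hasDerivWithinAt (s := Set.Ioi t)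
    rw [hasDerivWithinAt_iff_tendsto_slope' (by simp)] at h
    refine ge_of_tendsto h ?_
    filter_upwards [self_mem_nhdsWithin] with s hs
    have hs' : t < s := hs
    have h0 : P t i j = 0 := by rw [hPinit]; exact Matrix.one_apply_ne hij
    rw [slope_def_field, h0, sub_zero]
    exact div_nonneg ((hstoch s hs'.le).1 i j) (sub_nonneg.2 hs'.le)
  · intro i
    have h : HasDerivAt (fun s => ∑ j, P s i j) (∑ j, Q i j) t :=
      HasDerivAt.fun_sum fun j _ => hPderiv i j
    have h1 := h.hasDerivWithinAt (s := Set.Ici t)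
    have h2 : HasDerivWithinAt (fun s => ∑ j, P s i j) 0 (Set.Ici t) t :=
      (hasDerivWithinAt_const t (Set.Ici t) (1 : ℝ)).congr
        (fun s hs => (hstoch s hs).2 i) ((hstoch t le_rfl).2 i)
    exact (uniqueDiffOn_Ici t t Set.self_mem_Ici).eq_deriv _ h1 h2
end

section
/- Let k ≥ 1, N ≥ 1 be natural numbers, let ν : Fin k → Fin k → ℝ satisfy 0 ≤ ν ℓ ℓ' ≤ R for all ℓ, ℓ', let n : Fin k → ℕ with ∑_ℓ n ℓ = N, and set x = (1/N) ∑_ℓ (n ℓ) • e_ℓ ∈ ℝ^k, where e_ℓ is the ℓ-th standard basis vector. Let F : ℝ^k → ℝ be twice continuously differentiable with ‖D²F(y)‖ ≤ M₂ for all y ∈ ℝ^k. Then | ∑_{ℓ,ℓ'} (n ℓ) · ν ℓ ℓ' · ( F(x + (1/N)(e_{ℓ'} − e_ℓ)) − F(x) ) − ∑_{ℓ,ℓ'} x_ℓ · ν ℓ ℓ' · (fderiv F x)(e_{ℓ'} − e_ℓ) | ≤ k · R · M₂ / N. (Proposition 2.6: the N-mean-field jump generator equals the first-order Koopman generator up to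 a remainder of order 1/N.) -/
theorem taylor2_aux {E : Type*} [NormedAddCommGroup E] [NormedSpace ℝ E] (F : E → ℝ) (M : ℝ)
    (hF : ContDiff ℝ 2 F) (hM : ∀ y, ‖fderiv ℝ (fderiv ℝ F) y‖ ≤ M) (x v : E) :
    |F (x + v) - F x - fderiv ℝ F x v| ≤ M * ‖v‖ ^ 2 / 2 := by
  have hd : Differentiable ℝ F := hF.differentiable (by norm_num)
  have hd2 : Differentiable ℝ (fderiv ℝ F) :=
    (hF.fderiv_right (m := 1) (by norm_num)).differentiable (by norm_num)
  have hg : ∀ t : ℝ, HasDerivAt (fun t : ℝ => F (x + t • v) - F x - t * fderiv ℝ F x v)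
      (fderiv ℝ F (x + t • v) v - fderiv ℝ F x v) t := by
    intro t
    have h1 : HasDerivAt (fun t : ℝ => x + t • v) v t := by
      simpa using ((hasDerivAt_id t).smul_const v).const_add x
    have h2 := (hd (x + t • v)).hasFDerivAt.comp_hasDerivAt t h1
    have h3 := (hasDerivAt_id t).mul_const (fderiv ℝ F x v)
    have h5 := (h2.sub_const (F x)).sub h3
    rw [one_mul] at h5
    exact h5
  have hB : ∀ t : ℝ, HasDerivAt (fun t : ℝ => M * ‖v‖ ^ 2 / 2 * t ^ 2) (M * ‖v‖ ^ 2 * t) t := by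
    intro t
    have := (hasDerivAt_pow 2 t).const_mul (M * ‖v‖ ^ 2 / 2)
    refine this.congr_deriv ?_
    norm_num
    ring
  have key := image_norm_le_of_norm_deriv_right_le_deriv_boundary (a := 0) (b := 1)
    (f := fun t : ℝ => F (x + t • v) - F x - t * fderiv ℝ F x v)
    (fun t _ => (hg t).continuousAt.continuousWithinAt)
    (fun t _ => (hg t).hasDerivWithinAt)
    (B := fun t : ℝ => M * ‖v‖ ^ 2 / 2 * t ^ 2) (B' := fun t => M * ‖v‖ ^ 2 * t)
    (by simp) hB
    (by
      intro t ht
      have h := Convex.norm_image_sub_le_of_norm_fderiv_le (𝕜 := ℝ) (f := fderiv ℝ F)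
        (fun y _ => hd2 y) (fun y _ => hM y) convex_univ (Set.mem_univ x)
        (Set.mem_univ (x + t • v))
      rw [← _root_.sub_apply]
      refine (ContinuousLinearMap.le_opNorm _ _).trans ?_
      have h4 : ‖x + t • v - x‖ = t * ‖v‖ := by
        rw [add_sub_cancel_left, norm_smul, Real.norm_of_nonneg ht.1]
      rw [h4] at h
      calc _ ≤ M * (t * ‖v‖) * ‖v‖ := mul_le_mul_of_nonneg_right h (norm_nonneg _)
        _ = _ := by ring)
    (Set.right_mem_Icc.2 zero_le_one)
  simpa using key

theorem norm_single_sub_aux {k : ℕ} (i j : Fin k) :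
    ‖(EuclideanSpace.single i (1:ℝ) - EuclideanSpace.single j (1:ℝ) :
      EuclideanSpace ℝ (Fin k))‖ ^ 2 ≤ 2 := by
  rw [norm_sub_sq_real]
  have : (0:ℝ) ≤ inner ℝ (EuclideanSpace.single i (1:ℝ) : EuclideanSpace ℝ (Fin k))
      (EuclideanSpace.single j (1:ℝ)) := by
    rw [EuclideanSpace.inner_single_left]
    simp [Pi.single_apply]
    split_ifs <;> norm_num
  simp only [PiLp.norm_single, norm_one]
  linarith

/-- Proposition 2.6: the `N`-mean-field jump generator applied to a twice continuously
differentiable function `F` equals the first-order Koopman generator up to a remainder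
of order `1/N`. -/
theorem stmt_5 (k N : ℕ) (hk : 1 ≤ k) (hN : 1 ≤ N) (R M₂ : ℝ)
    (ν : Fin k → Fin k → ℝ)
    (hν : ∀ ℓ ℓ', 0 ≤ ν ℓ ℓ' ∧ ν ℓ ℓ' ≤ R)
    (n : Fin k → ℕ) (hn : ∑ ℓ, n ℓ = N)
    (x : EuclideanSpace ℝ (Fin k))
    (hx : x = (N : ℝ)⁻¹ • ∑ ℓ, (n ℓ : ℝ) • (EuclideanSpace.single ℓ (1:ℝ)))
    (F : EuclideanSpace ℝ (Fin k) → ℝ) (hF : ContDiff ℝ 2 F)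
    (hM₂ : ∀ y, ‖fderiv ℝ (fderiv ℝ F) y‖ ≤ M₂) :
    |(∑ ℓ, ∑ ℓ', (n ℓ : ℝ) * ν ℓ ℓ' *
        (F (x + (N : ℝ)⁻¹ •
            (EuclideanSpace.single ℓ' (1:ℝ) - EuclideanSpace.single ℓ (1:ℝ))) - F x)) -
      ∑ ℓ, ∑ ℓ', x ℓ * ν ℓ ℓ' *
        (fderiv ℝ F x
          (EuclideanSpace.single ℓ' (1:ℝ) - EuclideanSpace.single ℓ (1:ℝ)))| ≤
      k * R * M₂ / N := by
  have hNpos : (0:ℝ) < N := by exact_mod_cast hN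
  have hM0 : 0 ≤ M₂ := le_trans (norm_nonneg (fderiv ℝ (fderiv ℝ F) x)) (hM₂ x)
  have hxl : ∀ ℓ, x ℓ = (N:ℝ)⁻¹ * n ℓ := by
    intro ℓ
    rw [hx]
    simp [Pi.single_apply]
  rw [← Finset.sum_sub_distrib]
  simp_rw [← Finset.sum_sub_distrib]
  have hterm : ∀ ℓ ℓ' : Fin k, |(n ℓ : ℝ) * ν ℓ ℓ' *
        (F (x + (N : ℝ)⁻¹ •
            (EuclideanSpace.single ℓ' (1:ℝ) - EuclideanSpace.single ℓ (1:ℝ))) - F x) -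
      x ℓ * ν ℓ ℓ' * (fderiv ℝ F x
          (EuclideanSpace.single ℓ' (1:ℝ) - EuclideanSpace.single ℓ (1:ℝ)))| ≤
      n ℓ * (R * (M₂ * ((N:ℝ)⁻¹) ^ 2)) := by
    intro ℓ ℓ'
    have ht := taylor2_aux F M₂ hF hM₂ x ((N : ℝ)⁻¹ •
            (EuclideanSpace.single ℓ' (1:ℝ) - EuclideanSpace.single ℓ (1:ℝ)))
    have hs := norm_single_sub_aux ℓ' ℓ
    rw [map_smul, smul_eq_mul, norm_smul, mul_pow, Real.norm_eq_abs, sq_abs] at ht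
    have ht2 := ht.trans (b := _) (c := M₂ * ((N:ℝ)⁻¹) ^ 2) (by
      have h0 : 0 ≤ M₂ * ((N:ℝ)⁻¹) ^ 2 := by positivity
      have := mul_le_mul_of_nonneg_left hs h0
      linarith)
    rw [hxl]
    obtain ⟨h0, h1⟩ := hν ℓ ℓ'
    have hR : 0 ≤ R := h0.trans h1
    calc _ = |(n ℓ : ℝ) * (ν ℓ ℓ' * (F (x + (N : ℝ)⁻¹ •
            (EuclideanSpace.single ℓ' (1:ℝ) - EuclideanSpace.single ℓ (1:ℝ))) - F x -
            (N : ℝ)⁻¹ * fderiv ℝ F x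
          (EuclideanSpace.single ℓ' (1:ℝ) - EuclideanSpace.single ℓ (1:ℝ))))| := by
          congr 1; ring
      _ ≤ _ := by
          rw [abs_mul, abs_mul, abs_of_nonneg h0, Nat.abs_cast]
          gcongr
  refine (Finset.abs_sum_le_sum_abs _ _).trans ?_
  refine (Finset.sum_le_sum fun ℓ _ => (Finset.abs_sum_le_sum_abs _ _).trans
    (Finset.sum_le_sum fun ℓ' _ => hterm ℓ ℓ')).trans ?_
  have hn' : ∑ ℓ, (n ℓ : ℝ) = N := by exact_mod_cast hn
  simp only [Finset.sum_const, Finset.card_univ, Fintype.card_fin, nsmul_eq_mul]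
  rw [← Finset.mul_sum, ← Finset.sum_mul, hn']
  apply le_of_eq
  field_simp
end

section
/- Let k ≥ 1 and let L¹, L² : ℝ → Matrix (Fin k) (Fin k) ℝ be continuous on [t,r]. Let U₁, U₂ : ℝ × ℝ → Matrix (Fin k) (Fin k) ℝ satisfy, for i = 1, 2: U_i(s,s) = 1 for all s; ∂_s U_i(t,s) = U_i(t,s) * L^i(s) (derivative in the second argument); and ∂_s U_i(s,r) = − L^i(s) * U_i(s,r) (derivative in the first argument), for t ≤ s ≤ r. Then U₂(t,r) − U₁(t,r) = ∫_t^r U₂(t,s) * (L²(s) − L¹(s)) * U₁(s,r) ds. (Proposition 5.1 i: the difference of two propagators is given by the Duhamel-type formula.) -/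
/-- Proposition 5.1 i): the difference of two propagators is given by the Duhamel-type
formula `U₂(t,r) − U₁(t,r) = ∫ₜʳ U₂(t,s)(L²(s) − L¹(s))U₁(s,r) ds`. -/
theorem stmt_11 (k : ℕ) (hk : 1 ≤ k) (t r : ℝ) (htr : t ≤ r)
    (L₁ L₂ : ℝ → Matrix (Fin k) (Fin k) ℝ)
    (hL₁ : ContinuousOn L₁ (Set.Icc t r)) (hL₂ : ContinuousOn L₂ (Set.Icc t r))
    (U₁ U₂ : ℝ → ℝ → Matrix (Fin k) (Fin k) ℝ)
    (hU₁id : ∀ s, U₁ s s = 1) (hU₂id : ∀ s, U₂ s s = 1)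
    (hU₁fwd : ∀ a s, t ≤ a → a ≤ s → s ≤ r → ∀ i j,
      HasDerivAt (fun σ => U₁ a σ i j) ((U₁ a s * L₁ s) i j) s)
    (hU₂fwd : ∀ a s, t ≤ a → a ≤ s → s ≤ r → ∀ i j,
      HasDerivAt (fun σ => U₂ a σ i j) ((U₂ a s * L₂ s) i j) s)
    (hU₁bwd : ∀ s b, t ≤ s → s ≤ b → b ≤ r → ∀ i j,
      HasDerivAt (fun σ => U₁ σ b i j) ((-(L₁ s * U₁ s b)) i j) s)
    (hU₂bwd : ∀ s b, t ≤ s → s ≤ b → b ≤ r → ∀ i j,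
      HasDerivAt (fun σ => U₂ σ b i j) ((-(L₂ s * U₂ s b)) i j) s) :
    ∀ i j, (U₂ t r - U₁ t r) i j =
      ∫ s in t..r, (U₂ t s * (L₂ s - L₁ s) * U₁ s r) i j := by
  intro i j
  have hd : ∀ s ∈ Set.uIcc t r, HasDerivAt (fun σ => (U₂ t σ * U₁ σ r) i j)
      ((U₂ t s * (L₂ s - L₁ s) * U₁ s r) i j) s := by
    intro s hs
    rw [Set.uIcc_of_le htr] at hs
    have h := HasDerivAt.fun_sum (u := Finset.univ) (fun l _ =>
      (hU₂fwd t s le_rfl hs.1 hs.2 i l).mul (hU₁bwd s r hs.1 hs.2 le_rfl l j))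
    have e : (U₂ t s * (L₂ s - L₁ s) * U₁ s r) =
        (U₂ t s * L₂ s) * U₁ s r + U₂ t s * (-(L₁ s * U₁ s r)) := by
      noncomm_ring
    rw [e, Matrix.add_apply, Matrix.mul_apply, Matrix.mul_apply (M := U₂ t s),
      ← Finset.sum_add_distrib]
    exact h
  have c2 : ContinuousOn (fun s => U₂ t s) (Set.Icc t r) :=
    continuousOn_pi.2 fun a => continuousOn_pi.2 fun b => fun s hs =>
      (hU₂fwd t s le_rfl hs.1 hs.2 a b).continuousAt.continuousWithinAt
  have c1 : ContinuousOn (fun s => U₁ s r) (Set.Icc t r) :=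
    continuousOn_pi.2 fun a => continuousOn_pi.2 fun b => fun s hs =>
      (hU₁bwd s r hs.1 hs.2 le_rfl a b).continuousAt.continuousWithinAt
  have c : ContinuousOn (fun s => U₂ t s * (L₂ s - L₁ s) * U₁ s r) (Set.Icc t r) :=
    (c2.mul (hL₂.sub hL₁)).mul c1
  have cij : ContinuousOn (fun s => (U₂ t s * (L₂ s - L₁ s) * U₁ s r) i j) (Set.uIcc t r) := by
    rw [Set.uIcc_of_le htr]
    exact continuousOn_pi.1 (continuousOn_pi.1 c i) j
  rw [intervalIntegral.integral_eq_sub_of_hasDerivAt hd cij.intervalIntegrable]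
  simp [hU₁id, hU₂id]
end

section
/- Let k ≥ 1 and let L¹, L² : ℝ → Matrix (Fin k) (Fin k) ℝ be continuous on [t,r]. Let U₁, U₂ : ℝ × ℝ → Matrix (Fin k) (Fin k) ℝ satisfy, for i = 1, 2: U_i(s,s) = 1; ∂_s U_i(t,s) = U_i(t,s) * L^i(s); ∂_s U_i(s,r) = − L^i(s) * U_i(s,r) for t ≤ s ≤ r; and the uniform operator-norm bound ‖U_i(s,s')‖ ≤ C₁ for all t ≤ s ≤ s' ≤ r. Then ‖U₂(t,r) − U₁(t,r)‖ ≤ C₁² · (r − t) · sup_{t ≤ s ≤ r} ‖L²(s) − L¹(s)‖. (Proposition 5.1 ii.) -/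
/-- The operator norm of a real `k × k` matrix induced by the Euclidean norm on `ℝ^k`. -/
noncomputable def matOpNorm {k : ℕ} (M : Matrix (Fin k) (Fin k) ℝ) : ℝ :=
  ‖Matrix.toEuclideanCLM (𝕜 := ℝ) M‖

open scoped Matrix.Norms.L2Operator in
theorem matOpNorm_eq_l2 {k : ℕ} (M : Matrix (Fin k) (Fin k) ℝ) : matOpNorm M = ‖M‖ := by
  rw [Matrix.l2_opNorm_def]; rfl

open scoped Matrix.Norms.L2Operator in
theorem hasDerivAt_of_entries {k : ℕ} (f : ℝ → Matrix (Fin k) (Fin k) ℝ)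
    (f' : Matrix (Fin k) (Fin k) ℝ) (s : ℝ)
    (h : ∀ i j, HasDerivAt (fun σ => f σ i j) (f' i j) s) : HasDerivAt f f' s := by
  have h1 : HasDerivAt (fun σ => ∑ i, ∑ j, f σ i j • Matrix.single i j (1 : ℝ))
      (∑ i, ∑ j, f' i j • Matrix.single i j (1 : ℝ)) s := by
    refine HasDerivAt.fun_sum fun i _ => HasDerivAt.fun_sum fun j _ => ?_
    exact (h i j).smul_const _
  have h2 : ∀ M : Matrix (Fin k) (Fin k) ℝ,
      ∑ i, ∑ j, M i j • Matrix.single i j (1 : ℝ) = M := by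
    intro M
    conv_rhs => rw [Matrix.matrix_eq_sum_single M]
    simp [Matrix.smul_single]
  simpa only [h2] using h1

open scoped Matrix.Norms.L2Operator in
/-- Proposition 5.1 ii): two uniformly bounded propagators with generators `L¹`, `L²`
differ in operator norm by at most `C₁²·(r−t)·sup_{t≤s≤r} ‖L²(s) − L¹(s)‖`. -/
theorem stmt_12 (k : ℕ) (hk : 1 ≤ k) (t r C₁ : ℝ) (htr : t ≤ r)
    (L₁ L₂ : ℝ → Matrix (Fin k) (Fin k) ℝ)
    (hL₁ : ContinuousOn L₁ (Set.Icc t r)) (hL₂ : ContinuousOn L₂ (Set.Icc t r))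
    (U₁ U₂ : ℝ → ℝ → Matrix (Fin k) (Fin k) ℝ)
    (hU₁id : ∀ s, U₁ s s = 1) (hU₂id : ∀ s, U₂ s s = 1)
    (hU₁fwd : ∀ a s, t ≤ a → a ≤ s → s ≤ r → ∀ i j,
      HasDerivAt (fun σ => U₁ a σ i j) ((U₁ a s * L₁ s) i j) s)
    (hU₂fwd : ∀ a s, t ≤ a → a ≤ s → s ≤ r → ∀ i j,
      HasDerivAt (fun σ => U₂ a σ i j) ((U₂ a s * L₂ s) i j) s)
    (hU₁bwd : ∀ s b, t ≤ s → s ≤ b → b ≤ r → ∀ i j,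
      HasDerivAt (fun σ => U₁ σ b i j) ((-(L₁ s * U₁ s b)) i j) s)
    (hU₂bwd : ∀ s b, t ≤ s → s ≤ b → b ≤ r → ∀ i j,
      HasDerivAt (fun σ => U₂ σ b i j) ((-(L₂ s * U₂ s b)) i j) s)
    (hU₁bound : ∀ s s', t ≤ s → s ≤ s' → s' ≤ r → matOpNorm (U₁ s s') ≤ C₁)
    (hU₂bound : ∀ s s', t ≤ s → s ≤ s' → s' ≤ r → matOpNorm (U₂ s s') ≤ C₁) :
    matOpNorm (U₂ t r - U₁ t r) ≤
      C₁ ^ 2 * (r - t) * ⨆ s : Set.Icc t r, matOpNorm (L₂ s - L₁ s) := by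
  simp only [matOpNorm_eq_l2] at *
  have hcont : ContinuousOn (fun s => ‖L₂ s - L₁ s‖) (Set.Icc t r) := (hL₂.sub hL₁).norm
  have hbdd : BddAbove (Set.range fun s : Set.Icc t r => ‖L₂ s - L₁ s‖) := by
    have := isCompact_Icc.bddAbove_image hcont
    rwa [Set.image_eq_range] at this
  have hC : 0 ≤ C₁ := (norm_nonneg _).trans (hU₁bound t t le_rfl le_rfl htr)
  set S := ⨆ s : Set.Icc t r, ‖L₂ s - L₁ s‖ with hS
  have hder : ∀ s ∈ Set.Icc t r, HasDerivWithinAt (fun σ => U₂ t σ * U₁ σ r)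
      (U₂ t s * (L₂ s - L₁ s) * U₁ s r) (Set.Icc t r) s := by
    intro s hs
    have h1 := hasDerivAt_of_entries _ _ s (hU₂fwd t s le_rfl hs.1 hs.2)
    have h2 := hasDerivAt_of_entries _ _ s (hU₁bwd s r hs.1 hs.2 le_rfl)
    have h3 := (h1.mul h2).hasDerivWithinAt (s := Set.Icc t r)
    have h4 : U₂ t s * (L₂ s - L₁ s) * U₁ s r =
        U₂ t s * L₂ s * U₁ s r + U₂ t s * -(L₁ s * U₁ s r) := by
      rw [Matrix.mul_neg, Matrix.mul_sub, Matrix.sub_mul, Matrix.mul_assoc _ (L₁ s), sub_eq_add_neg]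
    rw [h4]
    exact h3
  have hb : ∀ s ∈ Set.Ico t r, ‖U₂ t s * (L₂ s - L₁ s) * U₁ s r‖ ≤ C₁ ^ 2 * S := by
    intro s hs
    have hs' : s ∈ Set.Icc t r := Set.Ico_subset_Icc_self hs
    have e1 := hU₂bound t s le_rfl hs'.1 hs'.2
    have e2 := hU₁bound s r hs'.1 hs'.2 le_rfl
    have e3 : ‖L₂ s - L₁ s‖ ≤ S := le_ciSup hbdd ⟨s, hs'⟩
    calc _ ≤ ‖U₂ t s‖ * ‖L₂ s - L₁ s‖ * ‖U₁ s r‖ :=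
          (norm_mul_le _ _).trans (by gcongr; exact norm_mul_le _ _)
      _ ≤ C₁ * S * C₁ := by
          have : 0 ≤ S := (norm_nonneg _).trans e3
          gcongr
      _ = _ := by ring
  have key := norm_image_sub_le_of_norm_deriv_le_segment' hder hb r ⟨htr, le_rfl⟩
  simp only [hU₁id, hU₂id, mul_one, one_mul] at key
  linarith
end

section
/- Let k ≥ 1 and let A : ℝ × ℝ^k → Matrix (Fin k) (Fin k) ℝ be continuous with all entries bounded in absolute value by C, with nonnegative off-diagonal entries (A(s,x)_{ij} ≥ 0 for i ≠ j) for all (s,x). If x : [t₀,T] → ℝ^k is differentiable with x'(s) = (A(s, x(s)))ᵀ · x(s) for all s ∈ [t₀,T], and all coordinates of x(t₀) are nonnegative, then all coordinates of x(s) are nonnegative for every s ∈ [t₀,T]. (Positivity preservation for the kinetic equation: the nonlinear flow maps nonnegative measures to nonnegative measures, so that ρ_s remains in the space of measures as required in Hypothesis A.) -/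
lemma hasDerivAt_negsq (y : ℝ) :
    HasDerivAt (fun z : ℝ => (min z 0) ^ 2) (2 * min y 0) y := by
  have h : HasFDerivAt (fun z : ℝ => (min z 0) ^ 2 - ((min y 0) ^ 2 + 2 * min y 0 * (z - y)))
      (0 : ℝ →L[ℝ] ℝ) y := by
    refine Asymptotics.IsBigO.hasFDerivAt (𝕜 := ℝ) (n := 2) ?_ (by norm_num)
    refine Asymptotics.IsBigO.of_bound 1 (Filter.Eventually.of_forall fun z => ?_)
    rw [one_mul, norm_pow, norm_norm, Real.norm_eq_abs, Real.norm_eq_abs, sq_abs, abs_le]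
    rcases le_total z 0 with hz | hz <;> rcases le_total y 0 with hy | hy <;>
      simp only [min_eq_left, min_eq_right, hz, hy] <;> constructor <;> 
      nlinarith [mul_nonneg (abs_nonneg z) (abs_nonneg y), sq_nonneg z, sq_nonneg y, sq_nonneg (z-y), hz, hy]
  have h1 := h.hasDerivAt
  have h2 : HasDerivAt (fun z : ℝ => (min y 0) ^ 2 + 2 * min y 0 * (z - y)) (2 * min y 0) y := by
    simpa using (((hasDerivAt_id y).sub_const y).const_mul (2 * min y 0)).const_add ((min y 0) ^ 2)
  have h3 := h1.add h2
  refine (h3.congr_deriv (by simp)).congr_of_eventuallyEq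
    (Filter.Eventually.of_forall fun z => ?_)
  simp

lemma quad_bound {k : ℕ} (C : ℝ) (B : Matrix (Fin k) (Fin k) ℝ) (v : Fin k → ℝ)
    (hb : ∀ i j, |B i j| ≤ C) (ho : ∀ i j, i ≠ j → 0 ≤ B i j) :
    ∑ i, 2 * min (v i) 0 * ∑ j, B j i * v j ≤ (2 * C * k) * ∑ i, (min (v i) 0) ^ 2 := by
  have key : ∀ i j, 2 * min (v i) 0 * (B j i * v j)
      ≤ C * ((min (v i) 0) ^ 2 + (min (v j) 0) ^ 2) := by
    intro i j
    have h1 : min (v i) 0 * (B j i * v j) ≤ B j i * (min (v i) 0 * min (v j) 0) := by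
      by_cases hij : j = i
      · subst hij
        rcases le_total (v j) 0 with h | h
        · simp only [min_eq_left h]; linarith [mul_left_comm (v j) (B j j) (v j)]
        · simp [min_eq_right h]
      · have := mul_nonneg (ho j i hij) (mul_nonneg (neg_nonneg.2 (min_le_right (v i) 0))
          (sub_nonneg.2 (min_le_left (v j) 0)))
        nlinarith
    have hp : 0 ≤ min (v i) 0 * min (v j) 0 :=
      mul_nonneg_of_nonpos_of_nonpos (min_le_right _ _) (min_le_right _ _)
    have hC : 0 ≤ C := (abs_nonneg _).trans (hb i j)
    have h2 := mul_le_mul_of_nonneg_right ((le_abs_self _).trans (hb j i)) hp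
    have h3 := mul_nonneg hC (sq_nonneg (min (v i) 0 - min (v j) 0))
    nlinarith
  calc _ = ∑ i, ∑ j, 2 * min (v i) 0 * (B j i * v j) := by simp only [Finset.mul_sum]
    _ ≤ ∑ i, ∑ j, C * ((min (v i) 0) ^ 2 + (min (v j) 0) ^ 2) :=
      Finset.sum_le_sum fun i _ => Finset.sum_le_sum fun j _ => key i j
    _ = _ := by
      simp only [← Finset.mul_sum, Finset.sum_add_distrib, Finset.sum_const, Finset.card_univ,
        Fintype.card_fin, nsmul_eq_mul]
      ring

open Matrix in
/-- Positivity preservation for the kinetic equation `ẋ = A(s,x)ᵀ·x` with nonnegative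
off-diagonal entries and bounded entries: the nonlinear flow maps nonnegative vectors
(measures) to nonnegative vectors, as required in Hypothesis A. -/
theorem stmt_17 (k : ℕ) (hk : 1 ≤ k) (t₀ T C : ℝ)
    (A : ℝ → EuclideanSpace ℝ (Fin k) → Matrix (Fin k) (Fin k) ℝ)
    (hAcont : Continuous fun p : ℝ × EuclideanSpace ℝ (Fin k) => A p.1 p.2)
    (hAbound : ∀ s x i j, |A s x i j| ≤ C)
    (hAoffdiag : ∀ s x i j, i ≠ j → 0 ≤ A s x i j)
    (x : ℝ → EuclideanSpace ℝ (Fin k))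
    (hx : ∀ s ∈ Set.Icc t₀ T,
      HasDerivWithinAt x
        (Matrix.toEuclideanCLM (𝕜 := ℝ) (A s (x s))ᵀ (x s)) (Set.Icc t₀ T) s)
    (hx₀ : ∀ i, 0 ≤ x t₀ i) :
    ∀ s ∈ Set.Icc t₀ T, ∀ i, 0 ≤ x s i := by
  intro s hs
  have hd : ∀ t ∈ Set.Icc t₀ T, HasDerivWithinAt (fun t => ∑ i, (min (x t i) 0) ^ 2)
      (∑ i, 2 * min (x t i) 0 * ∑ j, A t (x t) j i * x t j) (Set.Icc t₀ T) t := by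
    intro t ht
    refine HasDerivWithinAt.fun_sum fun i _ => ?_
    have h1 := (EuclideanSpace.proj (𝕜 := ℝ) i).hasFDerivAt.comp_hasDerivWithinAt t (hx t ht)
    have h2 := (hasDerivAt_negsq (x t i)).comp_hasDerivWithinAt t h1
    refine HasDerivWithinAt.congr_deriv h2 ?_
    simp [Matrix.mulVec, dotProduct, Matrix.transpose_apply]
  have hg := le_gronwallBound_of_liminf_deriv_right_le (δ := 0) (K := 2 * C * k) (ε := 0)
    (fun t ht => (hd t ht).continuousWithinAt)
    (fun t ht r hr => ((hd t ⟨ht.1, ht.2.le⟩).mono_of_mem_nhdsWithin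
      (Icc_mem_nhdsGE_of_mem ht)).liminf_right_slope_le hr)
    (by simp [hx₀])
    (fun t _ => by
      simpa using quad_bound C (A t (x t)) (fun i => x t i) (hAbound t (x t))
        (hAoffdiag t (x t))) s hs
  intro i
  simp only [gronwallBound_ε0, zero_mul] at hg
  have h4 := (Finset.single_le_sum (f := fun i => (min (x s i) 0) ^ 2)
    (fun i _ => sq_nonneg _) (Finset.mem_univ i)).trans hg
  have h5 : min (x s i) 0 = 0 := pow_eq_zero_iff (two_ne_zero) |>.1 (le_antisymm h4 (sq_nonneg _))
  exact min_eq_right_iff.1 h5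
end
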